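/- arXiv:1604.07711 — 4 statements merged into one kernel-verified Lean document; each statement's English description precedes it below -/
import Mathlib

section
/- The partition space (𝒫, δ) admits midpoints: for all partitions X, Y ∈ 𝒫 there exists a partition M ∈ 𝒫 with δ(X, M) = δ(M, Y) = δ(X, Y)/2. -/
/-!
Partition spaces for consensus clustering (Jain, "Condorcet's Jury Theorem for
Consensus Clustering").  Labeled partitions are ℓ×m column-stochastic matrices
with entries in [0,1]; the group Π of ℓ×ℓ permutation matrices acts by left
multiplication; partitions are orbits; δ is induced by the Frobenius norm.
-/

namespace CJT

/-- ℓ×m real matrices. -/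
abbrev Mat (l m : ℕ) := Matrix (Fin l) (Fin m) ℝ

/-- `P` is an ℓ×ℓ permutation matrix. -/
def IsPermMatrix {l : ℕ} (P : Matrix (Fin l) (Fin l) ℝ) : Prop :=
  ∃ σ : Equiv.Perm (Fin l), ∀ i k, P i k = if σ i = k then 1 else 0

/-- `X` is a labeled partition: entries in `[0,1]`, columns summing to one. -/
def IsLabeled {l m : ℕ} (X : Mat l m) : Prop :=
  (∀ i j, 0 ≤ X i j ∧ X i j ≤ 1) ∧ ∀ j, (∑ i, X i j) = 1

/-- The orbit `[X] = {P X : P ∈ Π}` of a labeled partition. -/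
def orbit {l m : ℕ} (X : Mat l m) : Set (Mat l m) :=
  {Y | ∃ P : Matrix (Fin l) (Fin l) ℝ, IsPermMatrix P ∧ Y = P * X}

/-- The partition space 𝒫: all orbits of labeled partitions. -/
def PartitionSpace (l m : ℕ) : Set (Set (Mat l m)) :=
  {A | ∃ X : Mat l m, IsLabeled X ∧ A = orbit X}

/-- Frobenius (Euclidean) norm. -/
noncomputable def frobNorm {l m : ℕ} (X : Mat l m) : ℝ :=
  Real.sqrt (∑ i, ∑ j, (X i j) ^ 2)

/-- `δ(A, B) = min {‖X' − Y'‖ : X' ∈ A, Y' ∈ B}`. -/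
noncomputable def pdist {l m : ℕ} (A B : Set (Mat l m)) : ℝ :=
  sInf {d | ∃ X ∈ A, ∃ Y ∈ B, d = frobNorm (X - Y)}

theorem mem_orbit_iff {l m : ℕ} {X Y : Mat l m} :
    Y ∈ orbit X ↔ ∃ σ : Equiv.Perm (Fin l), Y = X.submatrix σ id := by
  have mul_eq (P : Matrix (Fin l) (Fin l) ℝ) (σ : Equiv.Perm (Fin l))
      (hP : ∀ i k, P i k = if σ i = k then 1 else 0) : P * X = X.submatrix σ id := by
    ext i j
    simp [Matrix.mul_apply, hP]
  constructor
  · rintro ⟨P, ⟨σ, hP⟩, rfl⟩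
    exact ⟨σ, mul_eq P σ hP⟩
  · rintro ⟨σ, rfl⟩
    exact ⟨Matrix.of fun i k => if σ i = k then 1 else 0, ⟨σ, fun _ _ => rfl⟩,
      (mul_eq _ σ fun _ _ => rfl).symm⟩

theorem orbit_submatrix {l m : ℕ} (X : Mat l m) (σ : Equiv.Perm (Fin l)) :
    orbit (X.submatrix σ id) = orbit X := by
  ext Y
  simp only [mem_orbit_iff]
  constructor
  · rintro ⟨τ, rfl⟩
    exact ⟨σ * τ, rfl⟩
  · rintro ⟨τ, rfl⟩
    exact ⟨σ⁻¹ * τ, by ext i j; simp⟩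

theorem IsLabeled.submatrix {l m : ℕ} {X : Mat l m} (hX : IsLabeled X)
    (σ : Equiv.Perm (Fin l)) : IsLabeled (X.submatrix σ id) :=
  ⟨fun i j => hX.1 (σ i) j, fun j => (Equiv.sum_comp σ fun i => X i j).trans (hX.2 j)⟩

/-- The set of labeled partitions is closed under midpoints. -/
theorem IsLabeled.midpoint {l m : ℕ} {X Y : Mat l m} (hX : IsLabeled X) (hY : IsLabeled Y) :
    IsLabeled ((1 / 2 : ℝ) • (X + Y)) := by
  refine ⟨fun i j => ?_, fun j => ?_⟩
  · have hx := hX.1 i j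
    have hy := hY.1 i j
    simp only [Matrix.smul_apply, Matrix.add_apply, smul_eq_mul]
    constructor <;> linarith
  · simp only [Matrix.smul_apply, Matrix.add_apply, smul_eq_mul, ← Finset.mul_sum,
      Finset.sum_add_distrib, hX.2, hY.2]
    norm_num

section Frobenius

attribute [local instance] Matrix.frobeniusNormedAddCommGroup Matrix.frobeniusNormedSpace

theorem frobNorm_eq_norm {l m : ℕ} (X : Mat l m) : frobNorm X = ‖X‖ := by
  simp [frobNorm, Matrix.frobenius_norm_def, Real.sqrt_eq_rpow]

theorem frobNorm_add_le {l m : ℕ} (X Y : Mat l m) :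
    frobNorm (X + Y) ≤ frobNorm X + frobNorm Y := by
  simpa only [frobNorm_eq_norm] using norm_add_le X Y

theorem frobNorm_smul {l m : ℕ} (c : ℝ) (X : Mat l m) :
    frobNorm (c • X) = |c| * frobNorm X := by
  simpa only [frobNorm_eq_norm, Real.norm_eq_abs] using norm_smul c X

end Frobenius

theorem frobNorm_submatrix {l m : ℕ} (X : Mat l m) (σ : Equiv.Perm (Fin l)) :
    frobNorm (X.submatrix σ id) = frobNorm X :=
  congrArg Real.sqrt (Equiv.sum_comp σ fun i => ∑ j, X i j ^ 2)

/-- The distance of two orbits is attained by permuting the rows of the first matrix only. -/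
theorem pdist_orbit {l m : ℕ} (X Y : Mat l m) :
    pdist (orbit X) (orbit Y) =
      ⨅ σ : Equiv.Perm (Fin l), frobNorm (X.submatrix σ id - Y) := by
  unfold pdist iInf
  congr 1
  ext d
  simp only [Set.mem_ofPred_eq, Set.mem_range, mem_orbit_iff]
  constructor
  · rintro ⟨_, ⟨σ, rfl⟩, _, ⟨τ, rfl⟩, rfl⟩
    refine ⟨σ * τ⁻¹, ?_⟩
    rw [← frobNorm_submatrix _ τ]
    congr 1
    ext i j
    simp
  · rintro ⟨σ, rfl⟩
    exact ⟨_, ⟨σ, rfl⟩, Y, ⟨1, rfl⟩, rfl⟩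

theorem pdist_orbit_le {l m : ℕ} (X Y : Mat l m) (σ : Equiv.Perm (Fin l)) :
    pdist (orbit X) (orbit Y) ≤ frobNorm (X.submatrix σ id - Y) :=
  (pdist_orbit X Y).trans_le (ciInf_le (Set.finite_range _).bddBelow σ)

theorem pdist_orbit_eq_of_forall_le {l m : ℕ} {X Y : Mat l m} {d : ℝ}
    (hd : frobNorm (X - Y) = d)
    (hle : ∀ σ : Equiv.Perm (Fin l), d ≤ frobNorm (X.submatrix σ id - Y)) :
    pdist (orbit X) (orbit Y) = d :=
  le_antisymm ((pdist_orbit_le X Y 1).trans_eq hd) ((pdist_orbit X Y).symm ▸ le_ciInf hle)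

theorem exists_pdist_orbit_eq {l m : ℕ} (X Y : Mat l m) :
    ∃ σ : Equiv.Perm (Fin l),
      frobNorm (X.submatrix σ id - Y) = pdist (orbit X) (orbit Y) :=
  (pdist_orbit X Y).symm ▸ exists_eq_ciInf_of_finite

/-- The partition space `(𝒫, δ)` admits midpoints: for all
partitions `X, Y ∈ 𝒫` there exists a partition `M ∈ 𝒫` with
`δ(X, M) = δ(M, Y) = δ(X, Y) / 2`. -/
theorem partitionSpace_midpoints (l m : ℕ) (hl : 1 ≤ l) (hm : 1 ≤ m)
    (A B : Set (Mat l m)) (hA : A ∈ PartitionSpace l m) (hB : B ∈ PartitionSpace l m) :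
    ∃ M ∈ PartitionSpace l m,
      pdist A M = pdist A B / 2 ∧ pdist M B = pdist A B / 2 := by
  obtain ⟨X₀, hX₀, rfl⟩ := hA
  obtain ⟨Y, hY, rfl⟩ := hB
  obtain ⟨σ, hσ⟩ := exists_pdist_orbit_eq X₀ Y
  rw [← orbit_submatrix X₀ σ] at hσ ⊢
  have hX := hX₀.submatrix σ
  generalize X₀.submatrix σ id = X at hσ hX ⊢
  set d := pdist (orbit X) (orbit Y)
  have hXM : frobNorm (X - (1 / 2 : ℝ) • (X + Y)) = d / 2 := by
    rw [show X - (1 / 2 : ℝ) • (X + Y) = (1 / 2 : ℝ) • (X - Y) by module, frobNorm_smul, hσ,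
      abs_of_pos one_half_pos]
    ring
  have hMY : frobNorm ((1 / 2 : ℝ) • (X + Y) - Y) = d / 2 := by
    rw [show (1 / 2 : ℝ) • (X + Y) - Y = (1 / 2 : ℝ) • (X - Y) by module, frobNorm_smul, hσ,
      abs_of_pos one_half_pos]
    ring
  refine ⟨_, ⟨_, hX.midpoint hY, rfl⟩, pdist_orbit_eq_of_forall_le hXM fun τ => ?_,
    pdist_orbit_eq_of_forall_le hMY fun τ => ?_⟩
  · have htri := frobNorm_add_le (X.submatrix τ id - (1 / 2 : ℝ) • (X + Y))
      ((1 / 2 : ℝ) • (X + Y) - Y)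
    rw [sub_add_sub_cancel] at htri
    linarith [pdist_orbit_le X Y τ]
  · have htri := frobNorm_add_le ((X - (1 / 2 : ℝ) • (X + Y)).submatrix τ id)
      (((1 / 2 : ℝ) • (X + Y)).submatrix τ id - Y)
    rw [frobNorm_submatrix, Matrix.submatrix_sub, Pi.sub_apply, Pi.sub_apply,
      sub_add_sub_cancel] at htri
    linarith [pdist_orbit_le X Y τ]

end CJT
end

section
/- Let Z' be a representation of an asymmetric partition Z (i.e. α_Z > 0). Then the Dirichlet domain D_{Z'} = {X ∈ 𝒳 : ‖X − Z'‖ ≤ ‖X − P Z'‖ for all P ∈ Π} is a fundamental domain for the action of Π on 𝒳: it is a closed connected subset of 𝒳, every X ∈ 𝒳 satisfies PX ∈ D_{Z'} for some P ∈ Π (equivalently 𝒳 = ⋃_{P ∈ Π} P·D_{Z'}), and P·D°_{Z'} ∩ D°_{Z'} = ∅ for every permutation matrix P ≠ I, where D°_{Z'} denotes the interior of D_{Z'} relative to the subspace topology on 𝒳. -/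
/-!
Partition spaces for consensus clustering (Jain, "Condorcet's Jury Theorem for
Consensus Clustering").  Labeled partitions are ℓ×m column-stochastic matrices
with entries in [0,1]; the group Π of ℓ×ℓ permutation matrices acts by left
multiplication; partitions are orbits; δ is induced by the Frobenius norm.
-/

namespace CJT

/-- The degree of asymmetry
`α_Z = min {‖Z' − P Z'‖ : Z' ∈ Z, P ∈ Π, P ≠ I}` of a partition `Z`. -/
noncomputable def asym {l m : ℕ} (A : Set (Mat l m)) : ℝ :=
  sInf {d | ∃ Z' ∈ A, ∃ P : Matrix (Fin l) (Fin l) ℝ,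
    IsPermMatrix P ∧ P ≠ 1 ∧ d = frobNorm (Z' - P * Z')}

/-- The set 𝒳 of labeled partitions, as a topological subspace of the space of
ℓ×m matrices. -/
abbrev LabeledSpace (l m : ℕ) := {X : Mat l m // IsLabeled X}

/-- The Dirichlet domain of a representation `Z'`, viewed inside 𝒳:
`D_{Z'} = {X ∈ 𝒳 : ‖X − Z'‖ ≤ ‖X − P Z'‖ for all P ∈ Π}`. -/
def dirichlet {l m : ℕ} (Z' : Mat l m) : Set (LabeledSpace l m) :=
  {X | ∀ P : Matrix (Fin l) (Fin l) ℝ, IsPermMatrix P →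
    frobNorm (X.1 - Z') ≤ frobNorm (X.1 - P * Z')}

/-- The permutation matrix of `σ`. -/
def permMat {l : ℕ} (σ : Equiv.Perm (Fin l)) : Matrix (Fin l) (Fin l) ℝ :=
  Matrix.of fun i k => if σ i = k then 1 else 0

lemma isPermMatrix_permMat {l : ℕ} (σ : Equiv.Perm (Fin l)) : IsPermMatrix (permMat σ) :=
  ⟨σ, fun _ _ => rfl⟩

lemma IsPermMatrix.exists_eq_permMat {l : ℕ} {P : Matrix (Fin l) (Fin l) ℝ}
    (hP : IsPermMatrix P) : ∃ σ, P = permMat σ := by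
  obtain ⟨σ, hσ⟩ := hP
  exact ⟨σ, by ext i k; exact hσ i k⟩

lemma permMat_mul_apply {l m : ℕ} (σ : Equiv.Perm (Fin l)) (X : Mat l m) (i : Fin l)
    (j : Fin m) : (permMat σ * X) i j = X (σ i) j := by
  simp [permMat, Matrix.mul_apply]

lemma permMat_mul_permMat_mul {l m : ℕ} (σ τ : Equiv.Perm (Fin l)) (X : Mat l m) :
    permMat σ * (permMat τ * X) = permMat (τ * σ) * X := by
  ext i j
  simp [permMat_mul_apply]

lemma permMat_one {l : ℕ} : permMat (1 : Equiv.Perm (Fin l)) = 1 := by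
  ext i k
  simp only [permMat, Matrix.of_apply, Matrix.one_apply, Equiv.Perm.one_apply]
  congr

lemma IsLabeled.permMat_mul {l m : ℕ} {X : Mat l m} (hX : IsLabeled X)
    (σ : Equiv.Perm (Fin l)) : IsLabeled (permMat σ * X) := by
  simp only [IsLabeled, permMat_mul_apply]
  exact ⟨fun i j => hX.1 (σ i) j, fun j => by rw [Equiv.sum_comp σ (X · j)]; exact hX.2 j⟩

lemma convex_setOf_isLabeled (l m : ℕ) : Convex ℝ {X : Mat l m | IsLabeled X} := by
  intro X hX Y hY a b ha hb hab
  have hsum : ∀ j, ∑ i, (a • X + b • Y) i j = 1 := fun j => by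
    simp [Finset.sum_add_distrib, ← Finset.mul_sum, hX.2 j, hY.2 j, hab]
  have hnonneg : ∀ i j, 0 ≤ (a • X + b • Y) i j := fun i j =>
    add_nonneg (mul_nonneg ha (hX.1 i j).1) (mul_nonneg hb (hY.1 i j).1)
  refine ⟨fun i j => ⟨hnonneg i j, ?_⟩, hsum⟩
  rw [← hsum j]
  exact Finset.single_le_sum (f := fun i => (a • X + b • Y) i j) (fun k _ => hnonneg k j)
    (Finset.mem_univ i)

/-- The Frobenius inner product. -/
def frobInner {l m : ℕ} (X Y : Mat l m) : ℝ := ∑ i, ∑ j, X i j * Y i j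

lemma frobInner_comm {l m : ℕ} (X Y : Mat l m) : frobInner X Y = frobInner Y X := by
  simp only [frobInner, mul_comm]

lemma frobInner_add_smul_left {l m : ℕ} (a b : ℝ) (X Y W : Mat l m) :
    frobInner (a • X + b • Y) W = a * frobInner X W + b * frobInner Y W := by
  simp [frobInner, Finset.mul_sum, ← Finset.sum_add_distrib, add_mul, mul_assoc]

lemma frobInner_permMat_mul {l m : ℕ} (σ : Equiv.Perm (Fin l)) (X Y : Mat l m) :
    frobInner (permMat σ * X) (permMat σ * Y) = frobInner X Y := by
  simp only [frobInner, permMat_mul_apply]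
  exact Equiv.sum_comp σ fun i => ∑ j, X i j * Y i j

lemma frobNorm_sub {l m : ℕ} (X Y : Mat l m) :
    frobNorm (X - Y) = √(frobInner X X - 2 * frobInner X Y + frobInner Y Y) := by
  rw [frobNorm]
  congr 1
  simp only [frobInner, Finset.mul_sum, ← Finset.sum_sub_distrib, ← Finset.sum_add_distrib]
  refine Finset.sum_congr rfl fun i _ => Finset.sum_congr rfl fun j _ => ?_
  rw [Matrix.sub_apply]
  ring

lemma frobInner_sub_nonneg {l m : ℕ} (X Y : Mat l m) :
    0 ≤ frobInner X X - 2 * frobInner X Y + frobInner Y Y := by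
  simp only [frobInner, Finset.mul_sum, ← Finset.sum_sub_distrib, ← Finset.sum_add_distrib]
  refine Finset.sum_nonneg fun i _ => Finset.sum_nonneg fun j _ => ?_
  nlinarith [sq_nonneg (X i j - Y i j)]

lemma frobNorm_permMat_mul_sub {l m : ℕ} (σ : Equiv.Perm (Fin l)) (X Y : Mat l m) :
    frobNorm (permMat σ * X - permMat σ * Y) = frobNorm (X - Y) := by
  simp only [frobNorm_sub, frobInner_permMat_mul]

/-- The Dirichlet domain is cut out of 𝒳 by linear inequalities. -/
lemma mem_dirichlet_iff {l m : ℕ} {Z : Mat l m} {X : LabeledSpace l m} :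
    X ∈ dirichlet Z ↔
      ∀ σ : Equiv.Perm (Fin l), frobInner X.1 (permMat σ * Z) ≤ frobInner X.1 Z := by
  have key (σ : Equiv.Perm (Fin l)) : frobNorm (X.1 - Z) ≤ frobNorm (X.1 - permMat σ * Z) ↔
      frobInner X.1 (permMat σ * Z) ≤ frobInner X.1 Z := by
    rw [frobNorm_sub, frobNorm_sub, Real.sqrt_le_sqrt_iff (frobInner_sub_nonneg _ _),
      frobInner_permMat_mul]
    constructor <;> intro h <;> linarith
  constructor
  · exact fun h σ => (key σ).1 (h _ (isPermMatrix_permMat σ))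
  · rintro h P hP
    obtain ⟨σ, rfl⟩ := hP.exists_eq_permMat
    exact (key σ).2 (h σ)

lemma isClosed_dirichlet {l m : ℕ} (Z : Mat l m) : IsClosed (dirichlet Z) := by
  have hcont (W : Mat l m) : Continuous fun X : LabeledSpace l m => frobInner X.1 W := by
    unfold frobInner
    exact continuous_finsetSum _ fun i _ => continuous_finsetSum _ fun j _ =>
      (continuous_subtype_val.matrix_elem i j).mul continuous_const
  have : dirichlet Z =
      ⋂ σ : Equiv.Perm (Fin l), {X : LabeledSpace l m |
        frobInner X.1 (permMat σ * Z) ≤ frobInner X.1 Z} := by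
    ext X
    simp [mem_dirichlet_iff]
  rw [this]
  exact isClosed_iInter fun σ => isClosed_le (hcont _) (hcont _)

lemma self_mem_dirichlet {l m : ℕ} {Z : Mat l m} (hZ : IsLabeled Z) :
    (⟨Z, hZ⟩ : LabeledSpace l m) ∈ dirichlet Z := by
  rw [mem_dirichlet_iff]
  intro σ
  have h := frobInner_sub_nonneg Z (permMat σ * Z)
  rw [frobInner_permMat_mul] at h
  dsimp only
  linarith

lemma convex_image_dirichlet {l m : ℕ} (Z : Mat l m) :
    Convex ℝ (Subtype.val '' dirichlet Z) := by
  rintro _ ⟨X, hX, rfl⟩ _ ⟨Y, hY, rfl⟩ a b ha hb hab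
  refine ⟨⟨_, convex_setOf_isLabeled l m X.2 Y.2 ha hb hab⟩, ?_, rfl⟩
  rw [mem_dirichlet_iff] at *
  intro σ
  simp only [frobInner_add_smul_left]
  exact add_le_add (mul_le_mul_of_nonneg_left (hX σ) ha) (mul_le_mul_of_nonneg_left (hY σ) hb)

lemma isConnected_dirichlet {l m : ℕ} {Z : Mat l m} (hZ : IsLabeled Z) :
    IsConnected (dirichlet Z) :=
  ⟨⟨_, self_mem_dirichlet hZ⟩,
    Topology.IsInducing.subtypeVal.isPreconnected_image.1 (convex_image_dirichlet Z).isPreconnected⟩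

lemma exists_permMat_mul_frobNorm_sub_le {l m : ℕ} (X Z : Mat l m) :
    ∃ σ : Equiv.Perm (Fin l), ∀ τ : Equiv.Perm (Fin l),
      frobNorm (permMat σ * X - Z) ≤ frobNorm (permMat σ * X - permMat τ * Z) := by
  obtain ⟨σ, hσ⟩ := Finite.exists_min fun σ : Equiv.Perm (Fin l) =>
    frobNorm (permMat σ * X - Z)
  refine ⟨σ, fun τ => (hσ (σ * τ⁻¹)).trans_eq ?_⟩
  rw [← frobNorm_permMat_mul_sub τ]
  simp [permMat_mul_permMat_mul]

/-- A point interior to the Dirichlet domain of `Z` is strictly closer to `Z` than to any other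
representation of `[Z]`. -/
lemma frobInner_permMat_mul_lt_of_mem_interior {l m : ℕ} {Z : Mat l m} (hZ : IsLabeled Z)
    {X : LabeledSpace l m} (hX : X ∈ interior (dirichlet Z)) {σ : Equiv.Perm (Fin l)}
    (hσ : 0 < frobNorm (Z - permMat σ * Z)) :
    frobInner X.1 (permMat σ * Z) < frobInner X.1 Z := by
  refine (mem_dirichlet_iff.1 (interior_subset hX) σ).lt_of_ne fun heq => ?_
  have hσZ := hZ.permMat_mul σ
  -- Move from `X` towards `σ Z` for a short time.
  let γ : unitInterval → LabeledSpace l m := fun t =>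
    ⟨(1 - t.1) • X.1 + t.1 • (permMat σ * Z),
      convex_setOf_isLabeled l m X.2 hσZ (by linarith [t.2.2]) t.2.1 (by ring)⟩
  have hγ : Continuous γ := by
    refine Continuous.subtype_mk ?_ _
    fun_prop
  have hγ0 : γ 0 = X := Subtype.ext (by simp [γ])
  have hnear : ∀ᶠ t in nhds (0 : unitInterval), γ t ∈ dirichlet Z :=
    hγ.continuousAt.eventually (by rw [hγ0]; exact mem_interior_iff_mem_nhds.1 hX)
  have : (nhdsWithin (0 : unitInterval) (Set.Ioi 0)).NeBot :=
    nhdsGT_neBot_of_exists_gt ⟨1, zero_lt_one⟩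
  obtain ⟨t, htD, ht⟩ :=
    ((hnear.filter_mono nhdsWithin_le_nhds).and
      (self_mem_nhdsWithin : Set.Ioi (0 : unitInterval) ∈ nhdsWithin 0 (Set.Ioi 0))).exists
  have ht' : (0 : ℝ) < t := ht
  have h := mem_dirichlet_iff.1 htD σ
  simp only [γ, frobInner_add_smul_left, frobInner_permMat_mul, heq] at h
  have hle : frobInner Z Z ≤ frobInner (permMat σ * Z) Z :=
    le_of_mul_le_mul_left (by linarith) ht'
  rw [frobNorm_sub, Real.sqrt_pos, frobInner_permMat_mul, frobInner_comm Z (permMat σ * Z)] at hσ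
  linarith

lemma frobNorm_sub_pos_of_asym_pos {l m : ℕ} {A : Set (Mat l m)} (hA : 0 < asym A)
    {Z : Mat l m} (hZ : Z ∈ A) {P : Matrix (Fin l) (Fin l) ℝ} (hP : IsPermMatrix P)
    (hP1 : P ≠ 1) : 0 < frobNorm (Z - P * Z) := by
  refine hA.trans_le (csInf_le ⟨0, ?_⟩ ⟨Z, hZ, P, hP, hP1, rfl⟩)
  rintro _ ⟨_, _, _, _, _, rfl⟩
  exact Real.sqrt_nonneg _

/-- If `Z'` represents an asymmetric partition `Z`, then the
Dirichlet domain `D_{Z'}` is a fundamental domain for the action of Π on 𝒳: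
it is closed and connected in the subspace topology of 𝒳, every `X ∈ 𝒳` has a
permuted copy `P X ∈ D_{Z'}` (so `𝒳 = ⋃_{P ∈ Π} P·D_{Z'}`), and
`P·D°_{Z'} ∩ D°_{Z'} = ∅` for every permutation matrix `P ≠ I`. -/
theorem dirichlet_fundamental_domain (l m : ℕ) (hl : 1 ≤ l) (hm : 1 ≤ m)
    (Z : Set (Mat l m)) (hZ : Z ∈ PartitionSpace l m) (hasym : 0 < asym Z)
    (Z' : Mat l m) (hZ' : Z' ∈ Z) :
    IsClosed (dirichlet Z') ∧
    IsConnected (dirichlet Z') ∧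
    (∀ X : LabeledSpace l m, ∃ P : Matrix (Fin l) (Fin l) ℝ, IsPermMatrix P ∧
      ∀ Q : Matrix (Fin l) (Fin l) ℝ, IsPermMatrix Q →
        frobNorm (P * X.1 - Z') ≤ frobNorm (P * X.1 - Q * Z')) ∧
    (∀ P : Matrix (Fin l) (Fin l) ℝ, IsPermMatrix P → P ≠ 1 →
      ∀ X ∈ interior (dirichlet Z'), ∀ Y ∈ interior (dirichlet Z'),
        Y.1 ≠ P * X.1) := by
  have hlab : IsLabeled Z' := by
    obtain ⟨W, hW, rfl⟩ := hZ
    obtain ⟨P, hP, rfl⟩ := hZ'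
    obtain ⟨σ, rfl⟩ := hP.exists_eq_permMat
    exact hW.permMat_mul σ
  refine ⟨isClosed_dirichlet Z', isConnected_dirichlet hlab, fun X => ?_, ?_⟩
  · obtain ⟨σ, hσ⟩ := exists_permMat_mul_frobNorm_sub_le X.1 Z'
    refine ⟨_, isPermMatrix_permMat σ, fun Q hQ => ?_⟩
    obtain ⟨τ, rfl⟩ := hQ.exists_eq_permMat
    exact hσ τ
  · intro P hP hP1 X hX Y hY hYX
    obtain ⟨σ, rfl⟩ := hP.exists_eq_permMat
    have hinv : permMat σ⁻¹ ≠ 1 := fun h => hP1 <| by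
      have := permMat_mul_permMat_mul σ σ⁻¹ (1 : Mat l l)
      rwa [h, inv_mul_cancel, permMat_one, Matrix.mul_one, Matrix.mul_one] at this
    have hlt := frobInner_permMat_mul_lt_of_mem_interior hlab hX
      (frobNorm_sub_pos_of_asym_pos hasym hZ' (isPermMatrix_permMat σ⁻¹) hinv)
    have hle := mem_dirichlet_iff.1 (interior_subset hY) σ
    rw [hYX, frobInner_permMat_mul, ← frobInner_permMat_mul σ⁻¹ (permMat σ * X.1) Z',
      permMat_mul_permMat_mul, mul_inv_cancel, permMat_one, Matrix.one_mul] at hle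
    exact absurd hle hlt.not_ge

end CJT
end

section
/- For p ∈ [0,1] and n ≥ 1 let pₙ = Σ_{i=r}^{n} C(n,i) pⁱ (1−p)^{n−i}, where r = ⌊n/2⌋ + 1 (the probability that a Binomial(n, p) random variable exceeds n/2). Then lim_{n→∞} pₙ = 1 if p > 1/2, lim_{n→∞} pₙ = 0 if p < 1/2, and lim_{n→∞} pₙ = 1/2 if p = 1/2. -/
open Filter

open Finset in
/-- Chebyshev's inequality for the binomial distribution. -/
theorem sum_binomial_le_of_sq_le {p : ℝ} (hp : p ∈ Set.Icc (0 : ℝ) 1) {n : ℕ} (hn : n ≠ 0)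
    {δ : ℝ} (hδ : δ ≠ 0) {s : Finset ℕ} (hs : s ⊆ range (n + 1))
    (hdev : ∀ i ∈ s, (n * δ) ^ 2 ≤ (n * p - i) ^ 2) :
    ∑ i ∈ s, (n.choose i : ℝ) * p ^ i * (1 - p) ^ (n - i) ≤ p * (1 - p) / δ ^ 2 / n := by
  have hq : 0 ≤ 1 - p := sub_nonneg.2 hp.2
  have hb (i : ℕ) : 0 ≤ (n.choose i : ℝ) * p ^ i * (1 - p) ^ (n - i) := by
    have := hp.1
    positivity
  have hvar : ∑ i ∈ range (n + 1),
      (n * p - i) ^ 2 * ((n.choose i : ℝ) * p ^ i * (1 - p) ^ (n - i)) = n * p * (1 - p) := by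
    have h := congrArg (Polynomial.eval p) (bernsteinPolynomial.variance ℝ n)
    simpa [bernsteinPolynomial, Polynomial.eval_finsetSum, mul_assoc] using h
  have hn' : (0 : ℝ) < n := by positivity
  rw [div_div, le_div_iff₀ (by positivity)]
  refine le_of_mul_le_mul_left ?_ hn'
  calc (n : ℝ) * ((∑ i ∈ s, (n.choose i : ℝ) * p ^ i * (1 - p) ^ (n - i)) * (δ ^ 2 * n))
      = ∑ i ∈ s, (n * δ) ^ 2 * ((n.choose i : ℝ) * p ^ i * (1 - p) ^ (n - i)) := by
        rw [← mul_sum]; ring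
    _ ≤ ∑ i ∈ s, (n * p - i) ^ 2 * ((n.choose i : ℝ) * p ^ i * (1 - p) ^ (n - i)) :=
        sum_le_sum fun i hi => mul_le_mul_of_nonneg_right (hdev i hi) (hb i)
    _ ≤ ∑ i ∈ range (n + 1), (n * p - i) ^ 2 * ((n.choose i : ℝ) * p ^ i * (1 - p) ^ (n - i)) :=
        sum_le_sum_of_subset_of_nonneg hs fun i _ _ => mul_nonneg (sq_nonneg _) (hb i)
    _ = n * (p * (1 - p)) := by rw [hvar]; ring

/-- A binomial probability of a sequence of events at distance at least `n * |δ|` from the mean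
tends to zero. -/
theorem tendsto_sum_binomial_zero {p : ℝ} (hp : p ∈ Set.Icc (0 : ℝ) 1) {δ : ℝ} (hδ : δ ≠ 0)
    {s : ℕ → Finset ℕ} (hs : ∀ n, s n ⊆ Finset.range (n + 1))
    (hdev : ∀ n, ∀ i ∈ s n, (n * δ) ^ 2 ≤ (n * p - i) ^ 2) :
    Tendsto (fun n : ℕ => ∑ i ∈ s n, (n.choose i : ℝ) * p ^ i * (1 - p) ^ (n - i))
      atTop (nhds 0) := by
  refine tendsto_of_tendsto_of_tendsto_of_le_of_le' tendsto_const_nhds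
    (tendsto_const_div_atTop_nhds_zero_nat (p * (1 - p) / δ ^ 2)) ?_ ?_
  · refine Eventually.of_forall fun n => Finset.sum_nonneg fun i _ => ?_
    have := hp.1
    have : 0 ≤ 1 - p := sub_nonneg.2 hp.2
    positivity
  · filter_upwards [eventually_ne_atTop 0] with n hn
    exact sum_binomial_le_of_sq_le hp hn hδ (hs n) (hdev n)

theorem sum_range_half_add_sum_Icc_majority (f : ℕ → ℝ) (n : ℕ) :
    ∑ i ∈ Finset.range (n / 2 + 1), f i + ∑ i ∈ Finset.Icc (n / 2 + 1) n, f i =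
      ∑ i ∈ Finset.range (n + 1), f i := by
  rw [← Finset.Ico_add_one_right_eq_Icc, Finset.sum_range_add_sum_Ico _ (by omega)]

theorem sum_range_binomial (p : ℝ) (n : ℕ) :
    ∑ i ∈ Finset.range (n + 1), (n.choose i : ℝ) * p ^ i * (1 - p) ^ (n - i) = 1 := by
  have h := add_pow p (1 - p) n
  rw [add_sub_cancel, one_pow] at h
  refine Eq.trans (Finset.sum_congr rfl fun i _ => ?_) h.symm
  ring

theorem sum_Icc_majority_choose (n : ℕ) :
    ∑ i ∈ Finset.Icc (n / 2 + 1) n, (n.choose i : ℝ) =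
      ∑ i ∈ Finset.range (n - n / 2), (n.choose i : ℝ) := by
  refine Finset.sum_nbij' (fun i => n - i) (fun i => n - i) ?_ ?_ ?_ ?_ ?_
  all_goals intro i hi
  all_goals simp only [Finset.mem_Icc, Finset.mem_range] at *
  any_goals omega
  rw [Nat.choose_symm hi.2]

theorem sq_centralBinom_mul_le (m : ℕ) : m.centralBinom ^ 2 * (2 * m + 1) ≤ 16 ^ m := by
  induction m with
  | zero => simp
  | succ m ih =>
    have h := Nat.succ_mul_centralBinom_succ m
    refine le_of_mul_le_mul_left ?_ (show 0 < (m + 1) ^ 2 by positivity)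
    calc (m + 1) ^ 2 * ((m + 1).centralBinom ^ 2 * (2 * (m + 1) + 1))
        = ((m + 1) * (m + 1).centralBinom) ^ 2 * (2 * m + 3) := by ring
      _ = m.centralBinom ^ 2 * (2 * m + 1) * (4 * ((2 * m + 1) * (2 * m + 3))) := by rw [h]; ring
      _ ≤ 16 ^ m * (4 * (4 * (m + 1) ^ 2)) := Nat.mul_le_mul ih (by nlinarith)
      _ = (m + 1) ^ 2 * 16 ^ (m + 1) := by ring

/-- The majority probability of a fair coin differs from `1 / 2` by at most
`1 / (2 * √(n + 1))`. -/
theorem sq_sum_majority_fair_sub_half_le (n : ℕ) :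
    ((∑ i ∈ Finset.Icc (n / 2 + 1) n, (n.choose i : ℝ)) / 2 ^ n - 1 / 2) ^ 2 ≤
      1 / 4 / (n + 1 : ℝ) := by
  have htot := sum_range_half_add_sum_Icc_majority (fun i => (n.choose i : ℝ)) n
  have hall : ∑ i ∈ Finset.range (n + 1), (n.choose i : ℝ) = 2 ^ n :=
    mod_cast Nat.sum_range_choose n
  have hsymm := sum_Icc_majority_choose n
  rw [hall] at htot
  set U := ∑ i ∈ Finset.Icc (n / 2 + 1) n, (n.choose i : ℝ)
  obtain ⟨m, rfl | rfl⟩ := n.even_or_odd'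
  · rw [show 2 * m - 2 * m / 2 = m by omega] at hsymm
    rw [show 2 * m / 2 = m by omega, Finset.sum_range_succ, ← hsymm,
      ← Nat.centralBinom_eq_two_mul_choose] at htot
    have hc : (m.centralBinom : ℝ) ^ 2 * (2 * m + 1) ≤ 16 ^ m :=
      mod_cast sq_centralBinom_mul_le m
    have hpow : ((2 : ℝ) ^ (2 * m)) ^ 2 = 16 ^ m := by
      rw [← pow_mul, mul_right_comm, pow_mul]; norm_num
    have hU : U / 2 ^ (2 * m) - 1 / 2 = -(m.centralBinom / 2 / 2 ^ (2 * m)) := by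
      field_simp
      linarith
    rw [hU, neg_sq, div_pow, hpow, div_pow, div_le_div_iff₀ (by positivity) (by positivity)]
    push_cast
    linarith
  · rw [show 2 * m + 1 - (2 * m + 1) / 2 = (2 * m + 1) / 2 + 1 by omega] at hsymm
    have hU : U / 2 ^ (2 * m + 1) - 1 / 2 = 0 := by
      field_simp
      linarith
    rw [hU, zero_pow two_ne_zero]
    positivity

theorem tendsto_sum_majority_fair :
    Tendsto (fun n : ℕ => (∑ i ∈ Finset.Icc (n / 2 + 1) n, (n.choose i : ℝ)) / 2 ^ n)
      atTop (nhds (1 / 2)) := by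
  have hlim : Tendsto (fun n : ℕ => 1 / 4 / (n + 1 : ℝ)) atTop (nhds 0) := by
    simpa using (tendsto_add_atTop_iff_nat 1).2
      (tendsto_const_div_atTop_nhds_zero_nat (1 / 4 : ℝ))
  have hsq := squeeze_zero (fun n => sq_nonneg _) sq_sum_majority_fair_sub_half_le hlim
  rw [tendsto_iff_dist_tendsto_zero]
  simpa [Real.sqrt_sq_eq_abs, Real.dist_eq] using hsq.sqrt

/-- For `p ∈ [0,1]` and `n ≥ 1` let
`pₙ = Σ_{i=r}^{n} C(n,i) pⁱ (1−p)^{n−i}` with `r = ⌊n/2⌋ + 1` (the probability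
that a Binomial(n, p) random variable exceeds `n/2`).  Then `pₙ → 1` if
`p > 1/2`, `pₙ → 0` if `p < 1/2`, and `pₙ → 1/2` if `p = 1/2`. -/
theorem condorcet_majority_limit (p : ℝ) (hp : p ∈ Set.Icc (0 : ℝ) 1) :
    (1 / 2 < p → Tendsto
      (fun n : ℕ => ∑ i ∈ Finset.Icc (n / 2 + 1) n,
        (n.choose i : ℝ) * p ^ i * (1 - p) ^ (n - i)) atTop (nhds 1)) ∧
    (p < 1 / 2 → Tendsto
      (fun n : ℕ => ∑ i ∈ Finset.Icc (n / 2 + 1) n,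
        (n.choose i : ℝ) * p ^ i * (1 - p) ^ (n - i)) atTop (nhds 0)) ∧
    (p = 1 / 2 → Tendsto
      (fun n : ℕ => ∑ i ∈ Finset.Icc (n / 2 + 1) n,
        (n.choose i : ℝ) * p ^ i * (1 - p) ^ (n - i)) atTop (nhds (1 / 2))) := by
  refine ⟨fun h => ?_, fun h => ?_, ?_⟩
  · have hlow := tendsto_sum_binomial_zero hp (sub_pos.2 h).ne'
      (s := fun n => Finset.range (n / 2 + 1))
      (fun n => Finset.range_subset_range.2 (by omega)) fun n i hi => by
        have hi' : (2 : ℝ) * i ≤ n := by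
          rw [Finset.mem_range] at hi
          exact_mod_cast (by omega : 2 * i ≤ n)
        have h0 : 0 ≤ n * (p - 1 / 2) := mul_nonneg n.cast_nonneg (sub_pos.2 h).le
        exact pow_le_pow_left₀ h0 (by linarith) 2
    have hsub := hlow.const_sub 1
    rw [sub_zero] at hsub
    refine hsub.congr fun n => ?_
    rw [sub_eq_iff_eq_add', sum_range_half_add_sum_Icc_majority, sum_range_binomial]
  · refine tendsto_sum_binomial_zero hp (sub_pos.2 h).ne' (fun n i hi => ?_) fun n i hi => ?_
    · rw [Finset.mem_Icc] at hi
      exact Finset.mem_range.2 (by omega)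
    · have hi' : (n : ℝ) ≤ 2 * i := by
        rw [Finset.mem_Icc] at hi
        exact_mod_cast (by omega : n ≤ 2 * i)
      have h0 : 0 ≤ n * (1 / 2 - p) := mul_nonneg n.cast_nonneg (sub_pos.2 h).le
      rw [sub_sq_comm]
      exact pow_le_pow_left₀ h0 (by linarith) 2
  · rintro rfl
    refine tendsto_sum_majority_fair.congr fun n => ?_
    rw [Finset.sum_div]
    refine Finset.sum_congr rfl fun i hi => ?_
    rw [sub_half, mul_assoc, ← pow_add, Nat.add_sub_cancel' (Finset.mem_Icc.1 hi).2,
      one_div_pow, mul_one_div]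
end

section
/- Let 𝒮ₙ = (X₁, …, Xₙ) be a sample of n partitions and let M be a mean partition of 𝒮ₙ. Then the variation-based diversity is bounded by the pairwise diversity: F(M) := (1/n) Σᵢ δ(Xᵢ, M)² ≤ (1/n²) Σᵢ Σⱼ δ(Xᵢ, Xⱼ)² =: G(𝒮ₙ). -/
/-!
Partition spaces for consensus clustering (Jain, "Condorcet's Jury Theorem for
Consensus Clustering").  Labeled partitions are ℓ×m column-stochastic matrices
with entries in [0,1]; the group Π of ℓ×ℓ permutation matrices acts by left
multiplication; partitions are orbits; δ is induced by the Frobenius norm.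
-/

namespace CJT

/-- The Fréchet function `Fₙ(Z) = (1/n) Σᵢ δ(Xᵢ, Z)²` of a sample
`𝒮ₙ = (X₁, …, Xₙ)` of `n` partitions. -/
noncomputable def frechet {l m n : ℕ} (s : Fin n → Set (Mat l m)) (A : Set (Mat l m)) : ℝ :=
  (1 / (n : ℝ)) * ∑ i, (pdist (s i) A) ^ 2

/-- A mean partition of the sample `s`: a global minimizer of the Fréchet
function over the partition space 𝒫. -/
def IsMeanPartition {l m n : ℕ} (s : Fin n → Set (Mat l m)) (M : Set (Mat l m)) : Prop :=
  M ∈ PartitionSpace l m ∧ ∀ W ∈ PartitionSpace l m, frechet s M ≤ frechet s W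

/-- For a sample `𝒮ₙ = (X₁, …, Xₙ)` of `n ≥ 1` partitions
with mean partition `M`, the variation-based diversity is bounded by the
pairwise diversity:
`F(M) = (1/n) Σᵢ δ(Xᵢ, M)² ≤ (1/n²) Σᵢ Σⱼ δ(Xᵢ, Xⱼ)² = G(𝒮ₙ)`. -/
theorem variation_le_pairwise_diversity (l m : ℕ) (hl : 1 ≤ l) (hm : 1 ≤ m)
    (n : ℕ) (hn : 0 < n)
    (s : Fin n → Set (Mat l m)) (hs : ∀ i, s i ∈ PartitionSpace l m)
    (M : Set (Mat l m)) (hM : IsMeanPartition s M) :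
    (1 / (n : ℝ)) * ∑ i, (pdist (s i) M) ^ 2 ≤
      (1 / (n : ℝ) ^ 2) * ∑ i, ∑ j, (pdist (s i) (s j)) ^ 2 := by
  have hn' : (0 : ℝ) < n := Nat.cast_pos.mpr hn
  have frechet_le_sample (j : Fin n) : frechet s M ≤ frechet s (s j) := hM.2 _ (hs j)
  have card_mul_le : (n : ℝ) * frechet s M ≤ ∑ j, frechet s (s j) := by
    simpa using Finset.sum_le_sum fun j (_ : j ∈ Finset.univ) => frechet_le_sample j
  calc frechet s M = 1 / (n : ℝ) * (n * frechet s M) := by field_simp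
    _ ≤ 1 / (n : ℝ) * ∑ j, frechet s (s j) := by gcongr
    _ = (1 / (n : ℝ) ^ 2) * ∑ i, ∑ j, (pdist (s i) (s j)) ^ 2 := by
      simp only [frechet]
      rw [← Finset.mul_sum, Finset.sum_comm, ← mul_assoc, one_div_mul_one_div, ← pow_two]

end CJT
end
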